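/- arXiv:1401.4650 — 3 statements merged into one kernel-verified Lean document; each statement's English description precedes it below -/
import Mathlib

section
/- For every q ≥ 3 and every binary word β, any two consecutive words of the expansion list ε(β) have Hamming distance exactly 1, i.e., they differ in exactly one position. -/
/-- Hamming distance between two words (of the same length): number of differing positions. -/
def hamming (a b : List ℕ) : ℕ :=
  ((a.zip b).filter (fun p => p.1 ≠ p.2)).length

/-- The generalized reflected Gray code list `G_{n,q}` over the alphabet `{1,…,q-1}`. -/
def G (q : ℕ) : ℕ → List (List ℕ)
  | 0 => [[]]
  | n + 1 =>
    (List.range (q - 1)).flatMap (fun j =>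
      (if (j + 1) % 2 = 1 then G q n else (G q n).reverse).map (fun w => (j + 1) :: w))

/-- Replace the 1's of a binary word (first arg), read from left to right,
by the letters of the second word. -/
def subst : List ℕ → List ℕ → List ℕ
  | [], _ => []
  | 0 :: β, w => 0 :: subst β w
  | _ :: β, w => w.headD 0 :: subst β w.tail

/-- The expansion `ε(β)` of a binary word `β` w.r.t. the alphabet `{0,…,q-1}`. -/
def expand (q : ℕ) (β : List ℕ) : List (List ℕ) :=
  (G q (β.count 1)).map (fun w => subst β w)

/-- The trace of a word: replace every nonzero letter by 1. -/
def trace (w : List ℕ) : List ℕ := w.map (fun x => if x = 0 then 0 else 1)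

/-- The modified binary reflected Gray code list `C_n`. -/
def C : ℕ → List (List ℕ)
  | 0 => [[]]
  | n + 1 => (C n).reverse.map (fun w => 1 :: w) ++ (C n).map (fun w => 0 :: w)

/-- The Gray code list `F_n^{(k)}` of length-`n` binary words avoiding `k` consecutive 0's. -/
def F (k n : ℕ) : List (List ℕ) :=
  if h : n < k then C n
  else (List.range k).attach.flatMap (fun ℓ =>
    ((F k (n - 1 - ℓ.1)).reverse).map (fun w => List.replicate ℓ.1 0 ++ 1 :: w))
termination_by n
decreasing_by
  have := List.mem_range.mp ℓ.2
  omega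

/-- The list `H_{n,q}^{(k)}`. -/
def H (q k n : ℕ) : List (List ℕ) :=
  ((F k (n - 2)).zipIdx.map Prod.swap).flatMap (fun p =>
    if p.1 % 2 = 0 then expand q (1 :: (p.2 ++ [1]))
    else (expand q (1 :: (p.2 ++ [1]))).reverse)

/-- The list `S_{n,q}^{(k)}`. -/
def S (q k n : ℕ) : List (List ℕ) :=
  (H q k (n - k)).map (fun w => List.replicate k 0 ++ w)

/-- The `k`-Fibonacci numbers. -/
def kfib (k n : ℕ) : ℕ :=
  if n < k then 2 ^ n
  else ∑ i ∈ (Finset.range k).attach, kfib k (n - 1 - i.1)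
termination_by n
decreasing_by
  have := Finset.mem_range.mp i.2
  omega

/-- The list `F_n^{(k)}(u)` (second recursive definition). -/
def Faux (k : ℕ) : ℕ → ℕ → List (List ℕ)
  | 0, _ => [[]]
  | n + 1, 0 => (Faux k n (k - 1)).reverse.map (fun w => 1 :: w)
  | n + 1, u + 1 =>
    (Faux k n (k - 1)).reverse.map (fun w => 1 :: w) ++ (Faux k n u).map (fun w => 0 :: w)


theorem hamming_self' (a : List ℕ) : hamming a a = 0 := by
  induction a with
  | nil => rfl
  | cons c a ih => simpa [hamming] using ih

theorem hamming_comm' (a b : List ℕ) : hamming a b = hamming b a := by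
  induction a generalizing b with
  | nil => cases b <;> simp [hamming]
  | cons c a ih =>
    cases b with
    | nil => simp [hamming]
    | cons d b =>
      have := ih b
      simp only [hamming, List.zip_cons_cons, List.filter_cons] at this ⊢
      by_cases h : c = d
      · subst h; simpa using this
      · have h' : d ≠ c := fun e => h e.symm
        simpa [h, h'] using this

theorem hamming_cons_same (c : ℕ) (a b : List ℕ) :
    hamming (c :: a) (c :: b) = hamming a b := by
  simp [hamming]

theorem hamming_cons_ne (c d : ℕ) (a b : List ℕ) (h : c ≠ d) :
    hamming (c :: a) (d :: b) = hamming a b + 1 := by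
  simp [hamming, h]

def blk (L : List (List ℕ)) (j : ℕ) : List (List ℕ) :=
  (if (j + 1) % 2 = 1 then L else L.reverse).map (fun w => (j + 1) :: w)

theorem blk_ne (L : List (List ℕ)) (hL : L ≠ []) (j : ℕ) : blk L j ≠ [] := by
  unfold blk; split_ifs <;> simpa using hL

theorem blk_chain (L : List (List ℕ)) (h : L.IsChain (fun a b => hamming a b = 1)) (j : ℕ) :
    (blk L j).IsChain (fun a b => hamming a b = 1) := by
  unfold blk
  rw [List.isChain_map]
  simp only [hamming_cons_same]
  split_ifs
  · exact h
  · rw [List.isChain_reverse]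
    exact h.imp (fun a b hab => (hamming_comm' b a).trans hab)

theorem blk_link (L : List (List ℕ)) (j : ℕ) :
    ∀ x ∈ (blk L j).getLast?, ∀ y ∈ (blk L (j + 1)).head?, hamming x y = 1 := by
  intro x hx y hy
  unfold blk at hx hy
  have key : ∀ w, hamming ((j + 1) :: w) ((j + 1 + 1) :: w) = 1 := fun w => by
    rw [hamming_cons_ne _ _ _ _ (by omega), hamming_self']
  by_cases hj : (j + 1) % 2 = 1
  · have h2 : ¬ (j + 1 + 1) % 2 = 1 := by omega
    rw [if_pos hj] at hx
    rw [if_neg h2] at hy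
    simp only [List.getLast?_map, List.head?_map, List.head?_reverse, Option.mem_def,
      Option.map_eq_some_iff] at hx hy
    obtain ⟨u, hu, rfl⟩ := hx
    obtain ⟨v, hv, rfl⟩ := hy
    obtain rfl : u = v := by simpa [hu] using hv
    exact key u
  · have h2 : (j + 1 + 1) % 2 = 1 := by omega
    rw [if_neg hj] at hx
    rw [if_pos h2] at hy
    simp only [List.getLast?_map, List.head?_map, List.getLast?_reverse, Option.mem_def,
      Option.map_eq_some_iff] at hx hy
    obtain ⟨u, hu, rfl⟩ := hx
    obtain ⟨v, hv, rfl⟩ := hy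
    obtain rfl : u = v := by simpa [hu] using hv
    exact key u

theorem range_chain (L : List (List ℕ)) (hL : L ≠ [])
    (h : L.IsChain (fun a b => hamming a b = 1)) (m : ℕ) :
    ((List.range m).flatMap (blk L)).IsChain (fun a b => hamming a b = 1) := by
  induction m with
  | zero => simp
  | succ m ih =>
    rw [List.range_succ, List.flatMap_append, List.flatMap_singleton, List.isChain_append]
    refine ⟨ih, blk_chain L h m, ?_⟩
    cases m with
    | zero => simp
    | succ m =>
      rw [List.range_succ, List.flatMap_append, List.flatMap_singleton,
        List.getLast?_append_of_ne_nil _ (blk_ne L hL m)]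
      exact blk_link L m

theorem G_succ (q n : ℕ) : G q (n + 1) = (List.range (q - 1)).flatMap (blk (G q n)) := rfl

theorem G_ne (q : ℕ) (hq : 3 ≤ q) (n : ℕ) : G q n ≠ [] := by
  induction n with
  | zero => simp [G]
  | succ n ih =>
    rw [G_succ]
    intro h
    rw [List.flatMap_eq_nil_iff] at h
    exact blk_ne _ ih 0 (h 0 (List.mem_range.2 (by omega)))

theorem G_chain (q : ℕ) (hq : 3 ≤ q) (n : ℕ) :
    (G q n).IsChain (fun a b => hamming a b = 1) := by
  induction n with
  | zero => simp [G]
  | succ n ih => rw [G_succ]; exact range_chain _ (G_ne q hq n) ih _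

theorem G_length (q n : ℕ) : ∀ w ∈ G q n, w.length = n := by
  induction n with
  | zero => simp [G]
  | succ n ih =>
    intro w hw
    rw [G_succ, List.mem_flatMap] at hw
    obtain ⟨j, -, hw⟩ := hw
    unfold blk at hw
    rw [List.mem_map] at hw
    obtain ⟨v, hv, rfl⟩ := hw
    have : v ∈ G q n := by split_ifs at hv <;> simpa using hv
    simp [ih v this]

theorem hamming_subst (β : List ℕ) (hβ : ∀ x ∈ β, x = 0 ∨ x = 1) (a b : List ℕ)
    (ha : a.length = β.count 1) (hb : b.length = β.count 1) :
    hamming (subst β a) (subst β b) = hamming a b := by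
  induction β generalizing a b with
  | nil =>
    simp only [List.count_nil, List.length_eq_zero_iff] at ha hb
    subst ha; subst hb; rfl
  | cons x β ih =>
    have hβ' : ∀ x ∈ β, x = 0 ∨ x = 1 := fun y hy => hβ y (List.mem_cons_of_mem _ hy)
    rcases hβ x List.mem_cons_self with rfl | rfl
    · simp only [subst, hamming_cons_same]
      exact ih hβ' a b (by simpa using ha) (by simpa using hb)
    · cases a with
      | nil => simp at ha
      | cons c a =>
      cases b with
      | nil => simp at hb
      | cons d b =>
      have := ih hβ' a b (by simpa using ha) (by simpa using hb)
      simp only [subst, List.headD_cons, List.tail_cons]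
      by_cases h : c = d
      · rw [h, hamming_cons_same, hamming_cons_same, this]
      · rw [hamming_cons_ne _ _ _ _ h, hamming_cons_ne _ _ _ _ h, this]

/-- For every `q ≥ 3` and every binary word `β`, any two consecutive words of the
expansion list `ε(β)` differ in exactly one position. -/
theorem stmt_4 (q : ℕ) (hq : 3 ≤ q) (β : List ℕ) (hβ : ∀ x ∈ β, x = 0 ∨ x = 1)
    (i : ℕ) (a b : List ℕ)
    (ha : (expand q β)[i]? = some a) (hb : (expand q β)[i + 1]? = some b) :
    hamming a b = 1 := by
  unfold expand at ha hb
  rw [List.getElem?_map, Option.map_eq_some_iff] at ha hb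
  obtain ⟨u, hu, rfl⟩ := ha
  obtain ⟨v, hv, rfl⟩ := hb
  rw [hamming_subst β hβ u v (G_length _ _ _ (List.mem_of_getElem? hu))
    (G_length _ _ _ (List.mem_of_getElem? hv))]
  have hc := List.isChain_iff_getElem.1 (G_chain q hq (β.count 1))
  obtain ⟨h1, rfl⟩ := List.getElem?_eq_some_iff.1 hu
  obtain ⟨h2, rfl⟩ := List.getElem?_eq_some_iff.1 hv
  exact hc i h2
end

section
/- For every k ≥ 2 and n ≥ 1, the first word of the list F_n^{(k)} is the length-n prefix of the infinite periodic word (10^{k−1}1)(10^{k−1}1)(10^{k−1}1)…. -/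
theorem F_small (k n : ℕ) (h : n < k) : F k n = C n := by
  rw [F]; simp [h]

theorem F_big (k n : ℕ) (h : ¬ n < k) : F k n = (List.range k).flatMap (fun l =>
    ((F k (n - 1 - l)).reverse).map (fun w => List.replicate l 0 ++ 1 :: w)) := by
  rw [F, dif_neg h]
  rw [← List.flatMap_map (f := Subtype.val) (l := (List.range k).attach)
    (g := fun l => ((F k (n - 1 - l)).reverse).map (fun w => List.replicate l 0 ++ 1 :: w))]
  rw [List.attach_map_subtype_val]

theorem C_last (n : ℕ) : (C n).getLast? = some (List.replicate n 0) := by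
  induction n with
  | zero => simp [C]
  | succ n ih => simp [C, List.getLast?_append, ih, List.replicate_succ]

theorem F_first (k n : ℕ) (hk : 2 ≤ k) (w : List ℕ) (h : (F k n).getLast? = some w) :
    (F k (n + 1)).head? = some (1 :: w) := by
  by_cases hn : n + 1 < k
  · rw [F_small k n (by omega)] at h
    rw [F_small k _ hn]
    simp [C, List.head?_append, h]
  · rw [F_big k _ hn]
    obtain ⟨j, rfl⟩ : ∃ j, k = j + 1 := ⟨k - 1, by omega⟩
    rw [List.range_succ_eq_map]
    simp [List.head?_append, h]

theorem F_last (k n : ℕ) (hk : 2 ≤ k) (w : List ℕ) (h : (F k n).head? = some w) :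
    (F k (n + k)).getLast? = some (List.replicate (k - 1) 0 ++ 1 :: w) := by
  rw [F_big k _ (by omega)]
  obtain ⟨j, rfl⟩ : ∃ j, k = j + 1 := ⟨k - 1, by omega⟩
  rw [List.range_succ]
  have e : n + (j + 1) - 1 - j = n := by omega
  simp [List.getLast?_append, h, e]

theorem F_main (k : ℕ) (hk : 2 ≤ k) (n : ℕ) : ∀ m, n ≤ m → (F k n).head? =
      some (((List.replicate m (1 :: (List.replicate (k - 1) 0 ++ [1]))).flatten).take n) := by
  induction n using Nat.strong_induction_on with
  | _ n ih =>
    intro m hm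
    rcases n with _ | n
    · rw [F_small k 0 (by omega)]; simp [C]
    obtain ⟨m, rfl⟩ : ∃ j, m = j + 1 := ⟨m - 1, by omega⟩
    by_cases hn : n < k
    · rw [F_first k n hk (List.replicate n 0) (by rw [F_small k n hn]; exact C_last n)]
      have h1 : n - (k - 1) = 0 := by omega
      have h2 : min n (k - 1) = n := by omega
      simp [List.replicate_succ, List.take_append, h1, h2]
    · obtain ⟨r, rfl⟩ : ∃ r, n = r + k := ⟨n - k, by omega⟩
      rw [F_first k _ hk _ (F_last k r hk _ (ih r (by omega) m (by omega)))]
      have h1 : r + k - (k - 1) = r + 1 := by omega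
      have h2 : min (r + k) (k - 1) = k - 1 := by omega
      simp [List.replicate_succ, List.take_append, h1, h2]

/-- For every `k ≥ 2` and `n ≥ 1`, the first word of `F_n^{(k)}` is the length-`n` prefix
of the infinite periodic word `(10^{k-1}1)(10^{k-1}1)…`. -/
theorem stmt_10 (k n : ℕ) (hk : 2 ≤ k) (hn : 1 ≤ n) :
    (F k n).head? =
      some (((List.replicate n (1 :: (List.replicate (k - 1) 0 ++ [1]))).flatten).take n) := by
  exact F_main k hk n n le_rfl
end

section
/- For every k ≥ 2 and n ≥ 0, if α = a_1a_2…a_n and β = b_1b_2…b_n are two successive words in the list F_n^{(k)} and they differ (exactly) in position ℓ, then either ℓ = n or a_{ℓ+1} = b_{ℓ+1} = 1. -/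
def RR (a b : List ℕ) : Prop :=
  ∃ (p s : List ℕ) (x y : ℕ), a = p ++ x :: s ∧ b = p ++ y :: s ∧ x ≠ y ∧
    (s = [] ∨ ∃ t, s = 1 :: t)

theorem RR_symm {a b : List ℕ} (h : RR a b) : RR b a := by
  obtain ⟨p, s, x, y, h1, h2, h3, h4⟩ := h
  exact ⟨p, s, y, x, h2, h1, h3.symm, h4⟩

theorem RR_append (u : List ℕ) {a b : List ℕ} (h : RR a b) : RR (u ++ a) (u ++ b) := by
  obtain ⟨p, s, x, y, h1, h2, h3, h4⟩ := h
  exact ⟨u ++ p, s, x, y, by simp [h1], by simp [h2], h3, h4⟩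

theorem chain_rev {L : List (List ℕ)} (h : L.IsChain RR) : L.reverse.IsChain RR := by
  rw [List.isChain_reverse]
  exact h.imp (fun _ _ h => RR_symm h)

theorem chain_map (f : List ℕ → List ℕ) (hf : ∀ a b, RR a b → RR (f a) (f b))
    {L : List (List ℕ)} (h : L.IsChain RR) : (L.map f).IsChain RR := by
  rw [List.isChain_map]
  exact h.imp (fun a b h => hf a b h)

theorem C_ne (n : ℕ) : C n ≠ [] := by
  induction n with
  | zero => simp [C]
  | succ n ih => simp [C, ih]

theorem C_head (n : ℕ) : (C (n + 1)).head? = (C n).getLast?.map (fun w => 1 :: w) := by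
  have h := C_ne n
  cases h' : (C n).getLast? with
  | none => simp_all
  | some w => simp [C, List.head?_append, h']

theorem C_len (n : ℕ) : ∀ w ∈ C n, w.length = n := by
  induction n with
  | zero => simp [C]
  | succ n ih =>
    intro w hw
    simp only [C, List.mem_append, List.mem_map, List.mem_reverse] at hw
    rcases hw with ⟨v, hv, rfl⟩ | ⟨v, hv, rfl⟩ <;> simp [ih v hv]

theorem C_chain (n : ℕ) : (C n).IsChain RR := by
  induction n with
  | zero => simp [C]
  | succ n ih =>
    rw [C, List.isChain_append]
    refine ⟨chain_map _ (fun a b h => RR_append [1] h) (chain_rev ih),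
      chain_map _ (fun a b h => RR_append [0] h) ih, ?_⟩
    intro x hx y hy
    simp only [List.getLast?_map, List.getLast?_reverse, List.head?_map, Option.mem_def,
      Option.map_eq_some_iff] at hx hy
    obtain ⟨u, hu, rfl⟩ := hx
    obtain ⟨v, hv, rfl⟩ := hy
    have huv : u = v := by simpa [hu] using hv
    subst huv
    refine ⟨[], u, 1, 0, rfl, rfl, by simp, ?_⟩
    cases n with
    | zero => left; simpa [C] using hu.symm
    | succ n =>
      rw [C_head] at hu
      simp only [Option.map_eq_some_iff] at hu
      obtain ⟨t, _, rfl⟩ := hu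
      exact Or.inr ⟨t, rfl⟩

theorem F_lt {k n : ℕ} (h : n < k) : F k n = C n := by
  rw [F, dif_pos h]

theorem F_ge {k n : ℕ} (h : k ≤ n) : F k n = ((List.range k).map (fun l =>
    ((F k (n - 1 - l)).reverse).map (fun w => List.replicate l 0 ++ 1 :: w))).flatten := by
  rw [F, dif_neg (by omega), List.flatMap_def]
  congr 1
  rw [List.attach_map_val (l := List.range k) (f := fun l =>
    ((F k (n - 1 - l)).reverse).map (fun w => List.replicate l 0 ++ 1 :: w))]

theorem F_ne {k : ℕ} (hk : 2 ≤ k) (n : ℕ) : F k n ≠ [] := by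
  induction n using Nat.strong_induction_on with
  | _ n ih =>
    by_cases h : n < k
    · rw [F_lt h]; exact C_ne n
    · rw [F_ge (by omega)]
      intro h0
      rw [List.flatten_eq_nil_iff] at h0
      have := h0 _ (List.mem_map.2 ⟨0, by simp; omega, rfl⟩)
      simp at this
      exact ih (n - 1) (by omega) this

theorem F_head {k : ℕ} (hk : 2 ≤ k) (n : ℕ) :
    (F k (n + 1)).head? = (F k n).getLast?.map (fun w => 1 :: w) := by
  by_cases h : n + 1 < k
  · rw [F_lt h, F_lt (by omega)]; exact C_head n
  · have hne := F_ne hk n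
    rw [F_ge (by omega)]
    obtain ⟨m, rfl⟩ : ∃ m, k = m + 1 := ⟨k - 1, by omega⟩
    cases h' : (F (m + 1) n).getLast? with
    | none => simp_all
    | some w => simp [List.range_succ_eq_map, List.head?_append, h']

theorem F_len {k : ℕ} (n : ℕ) : ∀ w ∈ F k n, w.length = n := by
  induction n using Nat.strong_induction_on with
  | _ n ih =>
    by_cases h : n < k
    · rw [F_lt h]; exact C_len n
    · rw [F_ge (by omega)]
      intro w hw
      simp only [List.mem_flatten, List.mem_map, List.mem_range] at hw
      obtain ⟨_, ⟨l, hl, rfl⟩, hw⟩ := hw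
      simp only [List.mem_map, List.mem_reverse] at hw
      obtain ⟨v, hv, rfl⟩ := hw
      have := ih _ (by omega) v hv
      simp [this]; omega

theorem F_chain {k : ℕ} (hk : 2 ≤ k) (n : ℕ) : (F k n).IsChain RR := by
  induction n using Nat.strong_induction_on with
  | _ n ih =>
    by_cases h : n < k
    · rw [F_lt h]; exact C_chain n
    · rw [F_ge (by omega), List.isChain_flatten]
      · constructor
        · intro L hL
          simp only [List.mem_map, List.mem_range] at hL
          obtain ⟨l, hl, rfl⟩ := hL
          refine chain_map _ (fun a b h => ?_) (chain_rev (ih _ (by omega)))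
          exact RR_append _ (RR_append [1] h)
        · rw [List.isChain_map, List.isChain_iff_getElem]
          intro l hl x hx y hy
          simp only [List.length_range] at hl
          simp only [List.getElem_range, List.getLast?_map, List.getLast?_reverse,
            List.head?_map, List.head?_reverse, Option.mem_def,
            Option.map_eq_some_iff] at hx hy
          obtain ⟨u, hu, rfl⟩ := hx
          obtain ⟨v, hv, rfl⟩ := hy
          rw [show n - 1 - l = (n - 1 - (l + 1)) + 1 by omega, F_head hk, hv] at hu
          simp only [Option.map_some, Option.some.injEq] at hu
          subst hu
          refine ⟨List.replicate l 0, 1 :: v, 1, 0, rfl, ?_, by simp, Or.inr ⟨v, rfl⟩⟩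
          simp [List.replicate_succ']
      · simp [F_ne hk]

/-- If `α = a_1…a_n` and `β = b_1…b_n` are two successive words of `F_n^{(k)}` differing
exactly in position `ℓ` (positions being numbered `1,…,n`), then either `ℓ = n` or
`a_{ℓ+1} = b_{ℓ+1} = 1`.  (Here `a[j]?` is the letter at 0-based index `j`, i.e. at
position `j+1`.) -/
theorem stmt_13 (k n : ℕ) (hk : 2 ≤ k) (i ℓ : ℕ) (a b : List ℕ)
    (ha : (F k n)[i]? = some a) (hb : (F k n)[i + 1]? = some b)
    (hℓ1 : 1 ≤ ℓ) (hℓn : ℓ ≤ n)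
    (hdiff : ∀ j : ℕ, j < n → (a[j]? ≠ b[j]? ↔ j = ℓ - 1)) :
    ℓ = n ∨ (a[ℓ]? = some 1 ∧ b[ℓ]? = some 1) := by
  have hc := F_chain hk n
  rw [List.isChain_iff_getElem] at hc
  obtain ⟨h1, ha'⟩ := List.getElem?_eq_some_iff.1 ha
  obtain ⟨h2, hb'⟩ := List.getElem?_eq_some_iff.1 hb
  have hR := hc i h2
  rw [ha', hb'] at hR
  have hlen : a.length = n := F_len n a (List.mem_of_getElem? ha)
  obtain ⟨p, s, x, y, rfl, rfl, hxy, hs⟩ := hR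
  have hl : p.length = ℓ - 1 := by
    apply (hdiff p.length (by simp at hlen; omega)).1
    simpa using hxy
  obtain rfl : ℓ = p.length + 1 := by omega
  rcases hs with rfl | ⟨t, rfl⟩
  · left; simpa using hlen
  · right; constructor <;> simp [List.getElem?_append]
end
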